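/- Let n ≥ 1, let M : Fin n → ℝ, and let m_min, m_max, E_min, E_max, C_p, E be real numbers with C_p > 0, 0 < m_min, m_min ≤ M i ≤ m_max for every i, and 0 ≤ E_min ≤ E ≤ E_max. Let m⁽ⁱ⁾ ∈ {0, 1} for every i with ∑ᵢ m⁽ⁱ⁾ = 1, and let T⁽ⁱ⁾ be real numbers satisfying, for every i: T⁽ⁱ⁾ ≥ E/(C_p · M i) − (E_max/(C_p · m_min)) · (1 − m⁽ⁱ⁾), T⁽ⁱ⁾ ≤ E/(C_p · M i), T⁽ⁱ⁾ ≤ (E_max/(C_p · m_min)) · m⁽ⁱ⁾, and T⁽ⁱ⁾ ≥ (E_min/(C_p · m_max)) · m⁽ⁱ⁾. Then there is a unique index j with m⁽ʲ⁾ = 1; moreover T⁽ⁱ⁾ = 0 for every i ≠ j, T⁽ʲ⁾ = E/(C_p · M j), and consequently ∑ᵢ T⁽ⁱ⁾ = E/(C_p · (∑ᵢ m⁽ⁱ⁾ · M i)), i.e. the linear formulation exactly recovers the nonlinear temperature definition T = E/(C_p · m). -/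

import Mathlib

/-- In a nonnegative family summing to `1`, an entry equal to `1` forces all others to vanish. -/
theorem eq_zero_of_sum_eq_one {ι : Type*} [Fintype ι] {w : ι → ℝ} (hw : ∀ i, 0 ≤ w i)
    (hsum : ∑ i, w i = 1) {i j : ι} (hj : w j = 1) (hij : i ≠ j) : w i = 0 := by
  classical
  have hrest : ∑ k ∈ Finset.univ.erase j, w k = 0 := by
    have := Finset.add_sum_erase Finset.univ w (Finset.mem_univ j)
    linarith
  exact (Finset.sum_eq_zero_iff_of_nonneg fun k _ => hw k).1 hrest i
    (Finset.mem_erase.2 ⟨hij, Finset.mem_univ i⟩)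

open Finset in
/-- Any feasible point of the discretised linear formulation exactly recovers
the nonlinear temperature definition `T = E / (C_p m)`: there is a unique
selected level `j`, all other partial temperatures vanish, the selected one
equals `E/(C_p M j)`, and the sum of partial temperatures equals
`E/(C_p ∑ mb i M i)`. -/
theorem oven_discretisation_exact
    (n : ℕ) (hn : 1 ≤ n) (M : Fin n → ℝ)
    (mmin mmax Emin Emax Cp E : ℝ)
    (hCp : 0 < Cp) (hmmin : 0 < mmin)
    (hM : ∀ i, mmin ≤ M i ∧ M i ≤ mmax)
    (hEmin : 0 ≤ Emin) (hE₁ : Emin ≤ E) (hE₂ : E ≤ Emax)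
    (mb : Fin n → ℝ) (hbin : ∀ i, mb i = 0 ∨ mb i = 1)
    (hsum : ∑ i, mb i = 1)
    (Tp : Fin n → ℝ)
    (hlb : ∀ i, Tp i ≥ E / (Cp * M i) - Emax / (Cp * mmin) * (1 - mb i))
    (hub : ∀ i, Tp i ≤ E / (Cp * M i))
    (hub' : ∀ i, Tp i ≤ Emax / (Cp * mmin) * mb i)
    (hlb' : ∀ i, Tp i ≥ Emin / (Cp * mmax) * mb i) :
    (∃! j : Fin n, mb j = 1) ∧
    (∀ j : Fin n, mb j = 1 →
      (∀ i, i ≠ j → Tp i = 0) ∧ Tp j = E / (Cp * M j)) ∧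
    (∑ i, Tp i = E / (Cp * ∑ i, mb i * M i)) := by
  have hnonneg : ∀ i, 0 ≤ mb i := fun i => by rcases hbin i with h | h <;> simp [h]
  have hzero : ∀ {i j}, mb j = 1 → i ≠ j → mb i = 0 := fun hj hij =>
    eq_zero_of_sum_eq_one hnonneg hsum hj hij
  obtain ⟨j, hj⟩ : ∃ j, mb j = 1 := by
    by_contra! h
    simp [fun i => (hbin i).resolve_right (h i)] at hsum
  have hoff : ∀ i, mb i = 0 → Tp i = 0 := fun i hi =>
    le_antisymm (by simpa [hi] using hub' i) (by simpa [hi] using hlb' i)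
  have hon : ∀ i, mb i = 1 → Tp i = E / (Cp * M i) := fun i hi =>
    le_antisymm (hub i) (by simpa [hi] using hlb i)
  refine ⟨⟨j, hj, fun i hi => ?_⟩,
    fun k hk => ⟨fun i hik => hoff i (hzero hk hik), hon k hk⟩, ?_⟩
  · by_contra hij
    exact zero_ne_one ((hzero hj hij).symm.trans hi)
  · have hT : ∑ i, Tp i = Tp j := Fintype.sum_eq_single j fun i hij => hoff i (hzero hj hij)
    have hm : ∑ i, mb i * M i = mb j * M j :=
      Fintype.sum_eq_single j fun i hij => by rw [hzero hj hij, zero_mul]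
    rw [hT, hm, hj, one_mul, hon j hj]
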